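/- arXiv:2303.03900 — 2 statements merged into one kernel-verified Lean document; each statement's English description precedes it below -/
import Mathlib

section
/- Suppose the transportation cost function c is lower semicontinuous on 𝒵 × 𝒵, that there exist ẑ₀ ∈ 𝒵 and a constant C < ∞ with ∫ c(z, ẑ₀) dP̂(z) ≤ C, and that there exist a metric d on 𝒵 all of whose sublevel sets {z ∈ 𝒵 : d(z, ẑ) ≤ r} are compact and an exponent p ∈ ℕ such that c(z, ẑ) ≥ d(z, ẑ)^p for all z, ẑ ∈ 𝒵. Then for every ε ≥ 0 the ambiguity set B_ε(P̂) is compact in the topology of weak convergence. -/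
open MeasureTheory ENNReal Set

noncomputable section

/-- The set of couplings of two measures: probability measures on the product whose
first and second marginals are `Q` and `P`, respectively. -/
def couplings {α : Type*} [MeasurableSpace α] (Q P : Measure α) : Set (Measure (α × α)) :=
  {π | π.map Prod.fst = Q ∧ π.map Prod.snd = P}

/-- The optimal transport discrepancy `d_c(Q, P) = inf_π ∫ c dπ`. -/
def OTDiscrepancy {α : Type*} [MeasurableSpace α] (c : α → α → ℝ≥0∞) (Q P : Measure α) :
    ℝ≥0∞ :=
  ⨅ π ∈ couplings Q P, ∫⁻ p, c p.1 p.2 ∂π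

/-- The optimal transport ambiguity set `B_ε(P) = {Q : d_c(Q, P) ≤ ε}`. -/
def ambiguitySet {α : Type*} [MeasurableSpace α] (c : α → α → ℝ≥0∞)
    (P : ProbabilityMeasure α) (ε : ℝ) : Set (ProbabilityMeasure α) :=
  {Q | OTDiscrepancy c Q.toMeasure P.toMeasure ≤ ENNReal.ofReal ε}

open Filter Topology in
/-- Under weak convergence of a sequence of probability measures, the integral of a nonnegative
lower semicontinuous function does not exceed the limit inferior of the integrals. -/
theorem lintegral_le_liminf_of_lowerSemicontinuous {Ω : Type*} [TopologicalSpace Ω]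
    [MeasurableSpace Ω] [OpensMeasurableSpace Ω] [HasOuterApproxClosed Ω] {f : Ω → ℝ≥0∞}
    (hf : LowerSemicontinuous f) {μs : ℕ → ProbabilityMeasure Ω} {μ : ProbabilityMeasure Ω}
    (hμ : Tendsto μs atTop (𝓝 μ)) :
    ∫⁻ x, f x ∂μ.toMeasure ≤ liminf (fun i => ∫⁻ x, f x ∂(μs i).toMeasure) atTop := by
  have truncated (n : ℕ) : ∫⁻ x, f x ⊓ n ∂μ.toMeasure ≤
      liminf (fun i => ∫⁻ x, f x ∂(μs i).toMeasure) atTop := by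
    have hg : LowerSemicontinuous (fun x => f x ⊓ n) := hf.inf lowerSemicontinuous_const
    have hfin (x : Ω) : f x ⊓ n ≠ ∞ :=
      (inf_le_right.trans_lt (ENNReal.natCast_lt_top n)).ne
    have layercake (ν : Measure Ω) :
        ∫⁻ x, f x ⊓ n ∂ν = ∫⁻ t in Ioi (0 : ℝ), ν {x | t < (f x ⊓ n).toReal} := by
      rw [← lintegral_eq_lintegral_meas_lt ν (Eventually.of_forall fun x => toReal_nonneg)
        hg.measurable.ennreal_toReal.aemeasurable]
      simp_rw [ENNReal.ofReal_toReal (hfin _)]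
    calc ∫⁻ x, f x ⊓ n ∂μ.toMeasure
        = ∫⁻ t in Ioi (0 : ℝ), μ.toMeasure {x | t < (f x ⊓ n).toReal} := layercake _
      _ ≤ ∫⁻ t in Ioi (0 : ℝ),
            liminf (fun i => (μs i).toMeasure {x | t < (f x ⊓ n).toReal}) atTop := by
          refine setLIntegral_mono' measurableSet_Ioi fun t ht => ?_
          refine ProbabilityMeasure.le_liminf_measure_open_of_tendsto hμ ?_
          convert hg.isOpen_preimage (ENNReal.ofReal t) using 1
          ext x
          exact (ENNReal.ofReal_lt_iff_lt_toReal (le_of_lt ht) (hfin x)).symm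
      _ ≤ liminf (fun i => ∫⁻ t in Ioi (0 : ℝ),
            (μs i).toMeasure {x | t < (f x ⊓ n).toReal}) atTop :=
          lintegral_liminf_le fun i => Antitone.measurable fun s t hst =>
            measure_mono fun x hx => lt_of_le_of_lt hst hx
      _ ≤ liminf (fun i => ∫⁻ x, f x ∂(μs i).toMeasure) atTop := by
          simp_rw [← layercake]
          exact liminf_le_liminf (Eventually.of_forall fun i => lintegral_mono fun x => inf_le_left)
  have hsup (x : Ω) : f x = ⨆ n : ℕ, f x ⊓ n := by
    rw [← inf_iSup_eq, ENNReal.iSup_natCast, inf_top_eq]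
  calc ∫⁻ x, f x ∂μ.toMeasure = ∫⁻ x, ⨆ n : ℕ, f x ⊓ n ∂μ.toMeasure := lintegral_congr hsup
    _ = ⨆ n : ℕ, ∫⁻ x, f x ⊓ n ∂μ.toMeasure :=
        lintegral_iSup (fun n => hf.measurable.inf_const _) fun m n hmn x =>
          inf_le_inf_left _ (Nat.cast_le.2 hmn)
    _ ≤ _ := iSup_le truncated

open Filter in
theorem isClosed_setOf_lintegral_le_of_lowerSemicontinuous {Ω : Type*} [TopologicalSpace Ω]
    [TopologicalSpace.PseudoMetrizableSpace Ω] [TopologicalSpace.SeparableSpace Ω]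
    [MeasurableSpace Ω] [BorelSpace Ω] {f : Ω → ℝ≥0∞} (hf : LowerSemicontinuous f) (M : ℝ≥0∞) :
    IsClosed {μ : ProbabilityMeasure Ω | ∫⁻ x, f x ∂μ.toMeasure ≤ M} := by
  refine IsSeqClosed.isClosed fun μs μ hμs hμ => ?_
  refine (lintegral_le_liminf_of_lowerSemicontinuous hf hμ).trans ?_
  exact (liminf_le_liminf (Eventually.of_forall hμs)).trans_eq (liminf_const M)

section Coupling

variable {E : Type*} [TopologicalSpace E] [SecondCountableTopology E] [MeasurableSpace E]
  [BorelSpace E]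

/-- The couplings with second marginal `P` whose transportation cost is at most `M`. -/
def boundedCostCouplings (c : E → E → ℝ≥0∞) (P : ProbabilityMeasure E) (M : ℝ≥0∞) :
    Set (ProbabilityMeasure (E × E)) :=
  {π | π.map continuous_snd.measurable.aemeasurable = P ∧
    ∫⁻ p, c p.1 p.2 ∂π.toMeasure ≤ M}

theorem ambiguitySet_eq_iInter_image (c : E → E → ℝ≥0∞) (P : ProbabilityMeasure E) (ε : ℝ) :
    ambiguitySet c P ε = ⋂ η : {η : NNReal // 0 < η},
      (fun π : ProbabilityMeasure (E × E) => π.map continuous_fst.measurable.aemeasurable) ''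
        boundedCostCouplings c P (ENNReal.ofReal ε + (η : NNReal)) := by
  ext Q
  simp only [mem_iInter]
  constructor
  · rintro hQ ⟨η, hη⟩
    have hlt : OTDiscrepancy c Q.toMeasure P.toMeasure < ENNReal.ofReal ε + η :=
      lt_of_le_of_lt hQ (ENNReal.lt_add_right ENNReal.ofReal_ne_top (by simpa using hη.ne'))
    simp only [OTDiscrepancy, iInf_lt_iff] at hlt
    obtain ⟨π, ⟨hπQ, hπP⟩, hπ⟩ := hlt
    have : IsProbabilityMeasure (π.map Prod.fst) := hπQ ▸ Q.2
    have hprob : IsProbabilityMeasure π :=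
      Measure.isProbabilityMeasure_of_map Prod.fst
    exact ⟨⟨π, hprob⟩, ⟨Subtype.ext hπP, hπ.le⟩, Subtype.ext hπQ⟩
  · intro hQ
    refine ENNReal.le_of_forall_pos_le_add fun η hη _ => ?_
    obtain ⟨π, ⟨hπP, hπ⟩, rfl⟩ := hQ ⟨η, hη⟩
    refine (iInf₂_le π.toMeasure ⟨rfl, ?_⟩).trans hπ
    rw [← hπP]
    rfl

variable [TopologicalSpace.MetrizableSpace E]

theorem isClosed_boundedCostCouplings {c : E → E → ℝ≥0∞}
    (hc : LowerSemicontinuous (fun p : E × E => c p.1 p.2)) (P : ProbabilityMeasure E)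
    (M : ℝ≥0∞) : IsClosed (boundedCostCouplings c P M) :=
  (isClosed_eq (ProbabilityMeasure.continuous_map continuous_snd) continuous_const).inter
    (isClosed_setOf_lintegral_le_of_lowerSemicontinuous hc M)

theorem isCompact_boundedCostCouplings {c : E → E → ℝ≥0∞}
    (hc : LowerSemicontinuous (fun p : E × E => c p.1 p.2)) (P : ProbabilityMeasure E)
    {z₀ : E} (hP : ∫⁻ z, c z z₀ ∂P.toMeasure ≠ ∞) {δ : E → E → ℝ}
    (hδ_tri : ∀ x y z, δ x z ≤ δ x y + δ y z)
    (hδ_cpt : ∀ r, IsCompact {z | δ z z₀ ≤ r}) {p : ℕ} (hp : p ≠ 0)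
    (hcδ : ∀ x y, ENNReal.ofReal (δ x y ^ p) ≤ c x y) {M : ℝ≥0∞} (hM : M ≠ ∞) :
    IsCompact (boundedCostCouplings c P M) := by
  rw [← (isClosed_boundedCostCouplings hc P M).closure_eq]
  refine isCompact_closure_of_isTightMeasureSet ?_
  rw [isTightMeasureSet_iff_exists_isCompact_measure_compl_le]
  intro η hη
  set A := M + ∫⁻ z, c z z₀ ∂P.toMeasure
  have hA_top : A ≠ ∞ := ENNReal.add_ne_top.2 ⟨hM, hP⟩
  obtain ⟨n, hn⟩ : ∃ n : ℕ, A / η < n :=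
    ENNReal.exists_nat_gt (ENNReal.div_ne_top hA_top hη.ne')
  set r : ℝ := n + 1 with hr
  have hr_one : 1 ≤ r := by simp [hr]
  have hAr : A / ENNReal.ofReal r ≤ η := by
    refine ENNReal.div_le_of_le_mul ?_
    rw [mul_comm]
    have hnr : (n : ℝ≥0∞) ≤ ENNReal.ofReal r := by
      rw [← ENNReal.ofReal_natCast]
      exact ENNReal.ofReal_le_ofReal (by simp [hr])
    by_cases hη_top : η = ∞
    · rw [hη_top, ENNReal.mul_top (by simpa using lt_of_lt_of_le one_pos hr_one)]
      exact le_top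
    · exact (ENNReal.div_le_iff hη.ne' hη_top).1 (hn.le.trans hnr)
  have cost_large {x y : E} (h : r < δ x y) : ENNReal.ofReal r ≤ c x y :=
    (ENNReal.ofReal_le_ofReal (h.le.trans
      (le_self_pow₀ (hr_one.trans h.le) hp))).trans (hcδ x y)
  have hc₀ : Measurable (fun z => c z z₀) :=
    (hc.comp (Continuous.prodMk_left z₀)).measurable
  refine ⟨{z | δ z z₀ ≤ 2 * r} ×ˢ {z | δ z z₀ ≤ 2 * r}, (hδ_cpt _).prod (hδ_cpt _), ?_⟩
  rintro _ ⟨π, ⟨hπP, hπM⟩, rfl⟩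
  have hsub : ({z | δ z z₀ ≤ 2 * r} ×ˢ {z | δ z z₀ ≤ 2 * r})ᶜ ⊆
      {q : E × E | ENNReal.ofReal r ≤ c q.1 q.2 + c q.2 z₀} := by
    rintro ⟨x, y⟩ hxy
    by_contra hlt
    have hxy_le : δ x y ≤ r := by
      by_contra! h
      exact hlt ((cost_large h).trans le_self_add)
    have hy_le : δ y z₀ ≤ r := by
      by_contra! h
      exact hlt ((cost_large h).trans le_add_self)
    have := hδ_tri x y z₀
    exact hxy ⟨show δ x z₀ ≤ 2 * r by linarith, show δ y z₀ ≤ 2 * r by linarith⟩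
  have hsnd : ∫⁻ q : E × E, c q.2 z₀ ∂π.toMeasure = ∫⁻ z, c z z₀ ∂P.toMeasure := by
    rw [← hπP, ProbabilityMeasure.toMeasure_map, lintegral_map hc₀ measurable_snd]
  calc π.toMeasure ({z | δ z z₀ ≤ 2 * r} ×ˢ {z | δ z z₀ ≤ 2 * r})ᶜ
      ≤ π.toMeasure {q : E × E | ENNReal.ofReal r ≤ c q.1 q.2 + c q.2 z₀} := measure_mono hsub
    _ ≤ (∫⁻ q : E × E, c q.1 q.2 + c q.2 z₀ ∂π.toMeasure) / ENNReal.ofReal r :=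
        meas_ge_le_lintegral_div (hc.measurable.add (hc₀.comp measurable_snd)).aemeasurable
          (by simpa using lt_of_lt_of_le one_pos hr_one) ENNReal.ofReal_ne_top
    _ ≤ A / ENNReal.ofReal r := by
        rw [lintegral_add_left hc.measurable, hsnd]
        exact ENNReal.div_le_div_right (add_le_add_left hπM _) _
    _ ≤ η := hAr

end Coupling

/-- **Weak compactness of optimal transport ambiguity sets.**
If the transportation cost `c` on a nonempty closed set `𝒵 ⊆ ℝ^d` is lower semicontinuous,
satisfies the identity of indiscernibles, is `Phat`-integrably bounded at some reference point
`zhat0`, and dominates the `p`-th power of a metric `δ` on `𝒵` all of whose sublevel sets are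
compact, then for every `ε ≥ 0` the ambiguity set `B_ε(Phat)` is compact in the topology of
weak convergence of probability measures. -/
theorem ambiguitySet_isCompact {d : ℕ} (𝒵 : Set (Fin d → ℝ))
    (h𝒵closed : IsClosed 𝒵) (h𝒵ne : 𝒵.Nonempty)
    (c : 𝒵 → 𝒵 → ℝ≥0∞)
    (hc_id : ∀ z zhat : 𝒵, c z zhat = 0 ↔ z = zhat)
    (hc_lsc : LowerSemicontinuous (fun p : 𝒵 × 𝒵 => c p.1 p.2))
    (Phat : ProbabilityMeasure 𝒵)
    (zhat0 : 𝒵) (C : ℝ) (hC : ∫⁻ z, c z zhat0 ∂Phat.toMeasure ≤ ENNReal.ofReal C)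
    (δ : 𝒵 → 𝒵 → ℝ)
    (hδ_id : ∀ z zhat : 𝒵, δ z zhat = 0 ↔ z = zhat)
    (hδ_symm : ∀ z zhat : 𝒵, δ z zhat = δ zhat z)
    (hδ_tri : ∀ x y z : 𝒵, δ x z ≤ δ x y + δ y z)
    (hδ_cpt : ∀ (zhat : 𝒵) (r : ℝ), IsCompact {z : 𝒵 | δ z zhat ≤ r})
    (p : ℕ) (hp : 1 ≤ p)
    (hcδ : ∀ z zhat : 𝒵, ENNReal.ofReal (δ z zhat ^ p) ≤ c z zhat)
    (ε : ℝ) (hε : 0 ≤ ε) :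
    IsCompact (ambiguitySet c Phat ε) := by
  rw [ambiguitySet_eq_iInter_image]
  have image_compact (η : {η : NNReal // 0 < η}) :=
    (isCompact_boundedCostCouplings hc_lsc Phat (hC.trans_lt ENNReal.ofReal_lt_top).ne
      hδ_tri (hδ_cpt zhat0) (p := p) (by omega) hcδ
      (M := ENNReal.ofReal ε + (η : NNReal)) (by simp)).image
      (ProbabilityMeasure.continuous_map continuous_fst)
  exact (image_compact ⟨1, one_pos⟩).of_isClosed_subset
    (isClosed_iInter fun η => (image_compact η).isClosed) (iInter_subset _ _)
end
end

section
/- Fix ε ≥ 0. Suppose Θ is convex and ℓ(θ, z) is convex in θ for every z ∈ 𝒵. Assume: (a) c is lower semicontinuous on 𝒵 × 𝒵; (b) for every θ ∈ Θ, ℓ(θ, ·) is upper semicontinuous and P̂-integrable; (c) there exist ẑ₀ ∈ 𝒵 and C < ∞ with ∫ c(z, ẑ₀) dP̂(z) ≤ C; (d) there exist a metric d on 𝒵 with compact sublevel sets and p ∈ ℕ with c(z, ẑ) ≥ d(z, ẑ)^p for all z, ẑ ∈ 𝒵; (e) for every θ ∈ Θ there exist g > 0, ẑ₀ ∈ 𝒵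 and r ∈ (0, p) with ℓ(θ, z) ≤ g(1 + d(z, ẑ₀)^r) for all z ∈ 𝒵; (f) there exists Q ∈ B_ε(P̂) with inf_{θ ∈ Θ} ∫ ℓ(θ, z) dQ(z) > −∞. Then inf_{θ ∈ Θ} sup_{Q ∈ B_ε(P̂)} ∫ ℓ(θ, z) dQ(z) = sup_{Q ∈ B_ε(P̂)} inf_{θ ∈ Θ} ∫ ℓ(θ, z) dQ(z), and the supremum over Q on the right-hand side is attained. -/
open MeasureTheory ENNReal Set Filter Topology

noncomputable section

/-- The `[0,∞]`-valued positive part of an extended real number. -/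
def erealPos (x : EReal) : ℝ≥0∞ := if x = ⊤ then ⊤ else ENNReal.ofReal x.toReal

/-- The `(−∞,∞]`-valued integral of a `(−∞,∞]`-valued function. -/
def eint {α : Type*} [MeasurableSpace α] (μ : Measure α) (f : α → EReal) : EReal :=
  ((∫⁻ a, erealPos (f a) ∂μ : ℝ≥0∞) : EReal) - ((∫⁻ a, erealPos (-(f a)) ∂μ : ℝ≥0∞) : EReal)

/-- A family of `[0,∞]`-valued functions is uniformly `μ`-integrable. -/
def UnifIntegrableENN {α ι : Type*} [MeasurableSpace α] (μ : Measure α)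
    (F : ι → α → ℝ≥0∞) : Prop :=
  ∀ δ : ℝ, 0 < δ → ∃ K : ℝ, ∀ i : ι,
    ∫⁻ a in {a | ENNReal.ofReal K ≤ F i a}, F i a ∂μ ≤ ENNReal.ofReal δ

theorem lowerSemicontinuous_lintegral {X : Type*} [TopologicalSpace X]
    [TopologicalSpace.PseudoMetrizableSpace X] [TopologicalSpace.SeparableSpace X]
    [MeasurableSpace X] [BorelSpace X] {L : X → ℝ≥0∞} (hL : LowerSemicontinuous L) :
    LowerSemicontinuous fun μ : ProbabilityMeasure X => ∫⁻ x, L x ∂μ.toMeasure := by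
  have hcake (n : ℕ) (μ : ProbabilityMeasure X) : ∫⁻ x, min (L x) n ∂μ.toMeasure =
      ∫⁻ t in Ioi (0 : ℝ), μ.toMeasure {x | ENNReal.ofReal t < min (L x) n} := by
    have hne (x : X) : min (L x) n ≠ ⊤ := ne_top_of_le_ne_top (natCast_ne_top n) (min_le_right _ _)
    have h := lintegral_eq_lintegral_meas_lt μ.toMeasure (f := fun x => (min (L x) n).toReal)
      (Eventually.of_forall fun x => toReal_nonneg)
      (hL.measurable.min measurable_const).ennreal_toReal.aemeasurable
    simp only [ENNReal.ofReal_toReal (hne _)] at h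
    rw [h]
    refine setLIntegral_congr_fun measurableSet_Ioi fun t ht => ?_
    congr 1
    ext x
    exact (ENNReal.ofReal_lt_iff_lt_toReal (le_of_lt ht) (hne x)).symm
  have hmin (n : ℕ) : LowerSemicontinuous
      fun μ : ProbabilityMeasure X => ∫⁻ x, min (L x) n ∂μ.toMeasure := by
    refine lowerSemicontinuous_iff_le_liminf.2 fun μ => ?_
    simp only [hcake]
    have hmeas (ν : ProbabilityMeasure X) :
        Measurable fun t : ℝ => ν.toMeasure {x | ENNReal.ofReal t < min (L x) n} := by
      refine Antitone.measurable fun s t hst => measure_mono fun x hx => ?_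
      exact (ENNReal.ofReal_le_ofReal hst).trans_lt hx
    refine le_trans (lintegral_mono fun t => ?_)
      (lintegral_liminf_le' fun ν => (hmeas ν).aemeasurable)
    refine ProbabilityMeasure.le_liminf_measure_open_of_tendsto tendsto_id ?_
    have : {x | ENNReal.ofReal t < min (L x) n} =
        {x | ENNReal.ofReal t < L x} ∩ {_x | ENNReal.ofReal t < n} := by
      ext x; simp
    rw [this]
    exact (hL.isOpen_preimage _).inter isOpen_const
  have hsup (μ : ProbabilityMeasure X) :
      ∫⁻ x, L x ∂μ.toMeasure = ⨆ n : ℕ, ∫⁻ x, min (L x) n ∂μ.toMeasure := by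
    rw [← lintegral_iSup (fun n => hL.measurable.min measurable_const)]
    · refine lintegral_congr fun x => ?_
      have : ⨆ n : ℕ, L x ⊓ (n : ℝ≥0∞) = L x := by
        rw [← inf_iSup_eq, ENNReal.iSup_natCast, inf_top_eq]
      exact this.symm
    · intro a b hab x
      exact min_le_min_left _ (by exact_mod_cast hab)
  simp only [hsup]
  exact lowerSemicontinuous_iSup hmin

theorem isTightMeasureSet_of_lintegral_le {X : Type*} [TopologicalSpace X] [MeasurableSpace X]
    {S : Set (Measure X)} {V : X → ℝ≥0∞} (hV : Measurable V)
    (hK : ∀ r : ℝ≥0∞, r ≠ ⊤ → ∃ K : Set X, IsCompact K ∧ {x | V x ≤ r} ⊆ K) {M : ℝ≥0∞} (hM : M ≠ ⊤)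
    (hS : ∀ μ ∈ S, ∫⁻ x, V x ∂μ ≤ M) : IsTightMeasureSet S := by
  rw [isTightMeasureSet_iff_exists_isCompact_measure_compl_le]
  intro ε hε
  rcases eq_or_ne ε ⊤ with rfl | hε'
  · exact ⟨∅, isCompact_empty, fun _ _ => le_top⟩
  have hr : (M + 1) / ε ≠ ⊤ := ENNReal.div_ne_top (by finiteness) hε.ne'
  obtain ⟨K, hKc, hVK⟩ := hK _ hr
  refine ⟨K, hKc, fun μ hμ => ?_⟩
  have hle : μ Kᶜ ≤ μ {x | (M + 1) / ε ≤ V x} := measure_mono fun x hx =>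
    show (M + 1) / ε ≤ V x from le_of_not_ge fun h => hx (hVK h)
  refine hle.trans ((meas_ge_le_lintegral_div hV.aemeasurable
    (ENNReal.div_pos (by simp) hε').ne' hr).trans ?_)
  refine ENNReal.div_le_of_le_mul ?_
  rw [ENNReal.mul_div_cancel hε.ne' hε']
  exact (hS μ hμ).trans le_self_add

theorem exists_nonneg_weights {ι : Type*} [Fintype ι] [Nonempty ι] {S : Set (ι → ℝ)}
    (hS : Convex ℝ S) (hneg : ∀ x ∈ S, ∃ i, x i ≤ 0) :
    ∃ w : ι → ℝ, (∀ i, 0 ≤ w i) ∧ ∑ i, w i = 1 ∧ ∀ x ∈ S, ∑ i, w i * x i ≤ 0 := by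
  classical
  rcases S.eq_empty_or_nonempty with rfl | ⟨x₀, hx₀⟩
  · refine ⟨fun _ => (Fintype.card ι : ℝ)⁻¹, fun _ => by positivity, ?_, by simp⟩
    simp
  have hO : {x : ι → ℝ | ∀ i, 0 < x i} = univ.pi fun _ => Ioi 0 := by ext; simp
  obtain ⟨f, u, hfu, huf⟩ := geometric_hahn_banach_open (s := {x : ι → ℝ | ∀ i, 0 < x i})
    (t := S) (by rw [hO]; exact convex_pi fun _ _ => convex_Ioi 0)
    (by rw [hO]; exact isOpen_set_pi finite_univ fun _ _ => isOpen_Ioi) hS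
    (Set.disjoint_left.2 fun x hx hxS => by
      obtain ⟨i, hi⟩ := hneg x hxS
      exact absurd (hx i) hi.not_gt)
  have hf0 (x : ι → ℝ) (hx : ∀ i, 0 < x i) : f x ≤ 0 := by
    by_contra! h
    have := hfu ((|u| / f x + 1) • x) fun i => by
      have := hx i
      simp only [Pi.smul_apply, smul_eq_mul]
      positivity
    rw [map_smul, smul_eq_mul, add_mul, div_mul_cancel₀ _ h.ne'] at this
    linarith [le_abs_self u]
  have hf0' (x : ι → ℝ) (hx : ∀ i, 0 ≤ x i) : f x ≤ 0 := by
    have hlim : Tendsto (fun t : ℝ => f (x + t • 1)) (𝓝[>] 0) (𝓝 (f (x + (0 : ℝ) • 1))) := by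
      refine Tendsto.mono_left (Continuous.tendsto ?_ 0) nhdsWithin_le_nhds
      fun_prop
    rw [zero_smul, add_zero] at hlim
    refine le_of_tendsto hlim ?_
    filter_upwards [self_mem_nhdsWithin] with t ht
    refine hf0 _ fun i => ?_
    have : 0 < t := ht
    simpa using add_pos_of_nonneg_of_pos (hx i) this
  have hu : 0 ≤ u := by
    have hlim : Tendsto (fun t : ℝ => f (t • 1)) (𝓝[>] 0) (𝓝 (f ((0 : ℝ) • 1))) := by
      refine Tendsto.mono_left (Continuous.tendsto ?_ 0) nhdsWithin_le_nhds
      fun_prop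
    rw [zero_smul, map_zero] at hlim
    refine le_of_tendsto hlim ?_
    filter_upwards [self_mem_nhdsWithin] with t ht
    refine (hfu _ fun i => ?_).le
    simpa using ht
  have hsum (x : ι → ℝ) : f x = ∑ i, f (Pi.single i 1) * x i := by
    conv_lhs => rw [← Finset.univ_sum_single x, map_sum]
    refine Finset.sum_congr rfl fun i _ => ?_
    have : Pi.single i (x i) = x i • (Pi.single i 1 : ι → ℝ) := by
      rw [← Pi.single_smul]; simp
    rw [this, map_smul, smul_eq_mul, mul_comm]
  have hg (i : ι) : f (Pi.single i 1) ≤ 0 := hf0' _ fun j => by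
    by_cases h : j = i
    · subst h; simp
    · simp [h]
  have hW : ∑ i, f (Pi.single i 1) < 0 := by
    refine lt_of_le_of_ne (Finset.sum_nonpos fun i _ => hg i) fun h => ?_
    have hz := (Finset.sum_eq_zero_iff_of_nonpos fun i _ => hg i).1 h
    have hz' (x : ι → ℝ) : f x = 0 := by
      rw [hsum]
      exact Finset.sum_eq_zero fun i hi => by rw [hz i hi, zero_mul]
    have h1 := hfu 1 fun i => by simp
    have h2 := huf x₀ hx₀
    rw [hz'] at h1 h2
    linarith
  refine ⟨fun i => f (Pi.single i 1) / ∑ j, f (Pi.single j 1), fun i =>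
    div_nonneg_of_nonpos (hg i) hW.le, ?_, fun x hx => ?_⟩
  · rw [← Finset.sum_div, div_self hW.ne]
  · have : ∑ i, f (Pi.single i 1) / (∑ j, f (Pi.single j 1)) * x i
        = f x / ∑ j, f (Pi.single j 1) := by
      rw [hsum, Finset.sum_div]
      exact Finset.sum_congr rfl fun i _ => by ring
    rw [this]
    exact div_nonpos_of_nonneg_of_nonpos (hu.trans (huf x hx)) hW.le

theorem exists_pos_weights {ι : Type*} [Fintype ι] [Nonempty ι] {S : Set (ι → ℝ)}
    (hS : Convex ℝ S) (hneg : ∀ x ∈ S, ∃ i, x i ≤ 0) {K : ℝ} (hK : ∀ x ∈ S, ∀ i, x i ≤ K)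
    {η : ℝ} (hη : 0 < η) :
    ∃ w : ι → ℝ, (∀ i, 0 < w i) ∧ ∑ i, w i = 1 ∧ ∀ x ∈ S, ∑ i, w i * x i ≤ η := by
  obtain ⟨w, hw0, hw1, hwS⟩ := exists_nonneg_weights hS hneg
  have hcard : (0 : ℝ) < Fintype.card ι := by exact_mod_cast Fintype.card_pos
  set t : ℝ := η / (η + |K| + 1)
  have ht0 : 0 < t := by positivity
  have ht1 : t < 1 := (div_lt_one (by positivity)).2 (by linarith [abs_nonneg K])
  have htK : t * |K| ≤ η := by
    rw [div_mul_eq_mul_div, div_le_iff₀ (by positivity)]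
    nlinarith [abs_nonneg K]
  refine ⟨fun i => (1 - t) * w i + t / Fintype.card ι, fun i => ?_, ?_, fun x hx => ?_⟩
  · have := mul_nonneg (sub_nonneg.2 ht1.le) (hw0 i)
    positivity
  · rw [Finset.sum_add_distrib, ← Finset.mul_sum, hw1]
    simp only [Finset.sum_const, Finset.card_univ, nsmul_eq_mul]
    field_simp
    ring
  · have hxK : ∑ i, x i ≤ Fintype.card ι * |K| := by
      refine (Finset.sum_le_card_nsmul _ _ |K| fun i _ => (hK x hx i).trans (le_abs_self K)).trans ?_
      simp
    have hsplit : ∑ i, ((1 - t) * w i + t / Fintype.card ι) * x i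
        = (1 - t) * ∑ i, w i * x i + t / Fintype.card ι * ∑ i, x i := by
      rw [Finset.mul_sum, Finset.mul_sum, ← Finset.sum_add_distrib]
      exact Finset.sum_congr rfl fun i _ => by ring
    rw [hsplit]
    have h1 : (1 - t) * ∑ i, w i * x i ≤ 0 :=
      mul_nonpos_of_nonneg_of_nonpos (sub_nonneg.2 ht1.le) (hwS x hx)
    have h2 : t / Fintype.card ι * ∑ i, x i ≤ t / Fintype.card ι * (Fintype.card ι * |K|) :=
      mul_le_mul_of_nonneg_left hxK (by positivity)
    have h3 : t / Fintype.card ι * (Fintype.card ι * |K|) = t * |K| := by field_simp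
    linarith

theorem integrable_max_zero_of_lintegral_ofReal {X : Type*} [MeasurableSpace X] {μ : Measure X}
    {f : X → ℝ} (hf : Measurable f) (h : ∫⁻ x, ENNReal.ofReal (f x) ∂μ ≠ ⊤) :
    Integrable (fun x => max (f x) 0) μ := by
  refine ⟨(hf.max measurable_const).aestronglyMeasurable, ?_⟩
  rw [hasFiniteIntegral_iff_ofReal (Eventually.of_forall fun x => le_max_right (f x) 0)]
  simpa [ENNReal.ofReal_max] using h.lt_top

theorem integral_max_zero_eq_toReal {X : Type*} [MeasurableSpace X] {μ : Measure X}
    {f : X → ℝ} (hf : Measurable f) :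
    ∫ x, max (f x) 0 ∂μ = (∫⁻ x, ENNReal.ofReal (f x) ∂μ).toReal := by
  rw [integral_eq_lintegral_of_nonneg_ae (Eventually.of_forall fun x => le_max_right (f x) 0)
    (hf.max measurable_const).aestronglyMeasurable]
  simp [ENNReal.ofReal_max]

theorem lintegral_ofReal_sub_le_of_le_integral {X : Type*} [MeasurableSpace X] {μ : Measure X}
    [IsProbabilityMeasure μ] {f : X → ℝ} (hf : Measurable f) {N η v : ℝ} (hη : 0 ≤ η)
    (htail : ∫⁻ x, ENNReal.ofReal (f x - N) ∂μ ≤ ENNReal.ofReal η)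
    (hint : Integrable f μ) (hv : v ≤ ∫ x, f x ∂μ) :
    ∫⁻ x, ENNReal.ofReal (N - f x) ∂μ ≤ ENNReal.ofReal (N - v + η) := by
  have h1 : Integrable (fun x => N - f x) μ := (integrable_const N).sub hint
  have h2 : Integrable (fun x => f x - N) μ := hint.sub (integrable_const N)
  have hfin : ∫⁻ x, ENNReal.ofReal (N - f x) ∂μ ≠ ⊤ := h1.lintegral_lt_top.ne
  rw [← ENNReal.ofReal_toReal hfin,
    ← integral_max_zero_eq_toReal (f := fun x => N - f x) (measurable_const.sub hf)]
  refine ENNReal.ofReal_le_ofReal ?_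
  have hR : ∫ x, max (f x - N) 0 ∂μ ≤ η := by
    rw [integral_max_zero_eq_toReal (f := fun x => f x - N) (hf.sub measurable_const)]
    exact ENNReal.toReal_le_of_le_ofReal hη htail
  have hsplit : ∫ x, max (N - f x) 0 ∂μ = ∫ x, ((N - f x) + max (f x - N) 0) ∂μ := by
    refine integral_congr_ae (Eventually.of_forall fun x => ?_)
    rcases le_total (f x) N with h | h
    · simp [h]
    · simp [h]
  rw [hsplit, integral_add h1 h2.pos_part, integral_sub (integrable_const N) hint]
  simp only [integral_const, probReal_univ, one_smul]
  linarith

theorem integrable_and_le_integral_of_lintegral_ofReal_sub_le {X : Type*} [MeasurableSpace X]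
    {μ : Measure X} [IsProbabilityMeasure μ] {f : X → ℝ} (hf : Measurable f) {N η v : ℝ}
    (htail : ∫⁻ x, ENNReal.ofReal (f x - N) ∂μ ≤ ENNReal.ofReal η)
    (hN : 0 ≤ N - v + η)
    (h : ∫⁻ x, ENNReal.ofReal (N - f x) ∂μ ≤ ENNReal.ofReal (N - v + η)) :
    Integrable f μ ∧ v - η ≤ ∫ x, f x ∂μ := by
  have h1 := integrable_max_zero_of_lintegral_ofReal (μ := μ) (f := fun x => N - f x)
    (measurable_const.sub hf)
    (ne_top_of_le_ne_top ofReal_ne_top h)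
  have h2 := integrable_max_zero_of_lintegral_ofReal (μ := μ) (f := fun x => f x - N)
    (hf.sub measurable_const)
    (ne_top_of_le_ne_top ofReal_ne_top htail)
  have hfeq : f = fun x => N - max (N - f x) 0 + max (f x - N) 0 := by
    funext x
    rcases le_total (f x) N with h | h
    · simp [h]
    · simp [h]
  have hint : Integrable (fun x => N - max (N - f x) 0 + max (f x - N) 0) μ :=
    ((integrable_const N).sub h1).add h2
  refine ⟨hfeq ▸ hint, ?_⟩
  have hA : ∫ x, max (N - f x) 0 ∂μ ≤ N - v + η := by
    rw [integral_max_zero_eq_toReal (f := fun x => N - f x) (measurable_const.sub hf)]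
    exact ENNReal.toReal_le_of_le_ofReal hN h
  have hR : 0 ≤ ∫ x, max (f x - N) 0 ∂μ := integral_nonneg fun x => le_max_right _ _
  have : ∫ x, f x ∂μ = N - ∫ x, max (N - f x) 0 ∂μ + ∫ x, max (f x - N) 0 ∂μ := by
    have hsplit : ∫ x, f x ∂μ = ∫ x, (N - max (N - f x) 0 + max (f x - N) 0) ∂μ :=
      congrArg (fun h : X → ℝ => ∫ x, h x ∂μ) hfeq
    rw [hsplit, integral_add (f := fun x => N - max (N - f x) 0) ((integrable_const N).sub h1) h2,
      integral_sub (integrable_const N) h1]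
    simp
  linarith

theorem integrable_of_integrable_le_sum {X ι : Type*} [MeasurableSpace X] [Fintype ι]
    {μ : Measure X} {f : ι → X → ℝ} {g : X → ℝ} {w : ι → ℝ} (hw : ∀ i, 0 < w i)
    (hf : ∀ i, Measurable (f i)) (hpos : ∀ i, ∫⁻ x, ENNReal.ofReal (f i x) ∂μ ≠ ⊤)
    (hg : Integrable g μ) (hle : ∀ x, g x ≤ ∑ i, w i * f i x) (i : ι) : Integrable (f i) μ := by
  classical
  have hmax (j : ι) := integrable_max_zero_of_lintegral_ofReal (hf j) (hpos j)
  refine integrable_of_le_of_le (g₁ := fun x => (w i)⁻¹ * (g x - ∑ j, w j * max (f j x) 0))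
    (hf i).aestronglyMeasurable (Eventually.of_forall fun x => ?_)
    (Eventually.of_forall fun x => le_max_left _ _)
    ((hg.sub (integrable_finsetSum _ fun j _ => (hmax j).const_mul _)).const_mul _) (hmax i)
  rw [inv_mul_le_iff₀ (hw i)]
  have h1 := hle x
  have h2 : ∑ j, w j * f j x - w i * f i x ≤ ∑ j, w j * max (f j x) 0 := by
    rw [← Finset.add_sum_erase _ _ (Finset.mem_univ i), add_sub_cancel_left]
    refine (Finset.sum_le_sum fun j _ => mul_le_mul_of_nonneg_left (le_max_left (f j x) 0)
      (hw j).le).trans ?_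
    exact Finset.sum_le_univ_sum_of_nonneg fun j => mul_nonneg (hw j).le (le_max_right _ _)
  linarith

/-- The positive parts `(f - N)⁺` have uniformly small integrals over `B` for a suitable level. -/
def UniformUpperTail {X : Type*} [MeasurableSpace X] (B : Set (ProbabilityMeasure X))
    (f : X → ℝ) : Prop :=
  ∀ η : ℝ, 0 < η → ∃ N : ℝ, ∀ Q ∈ B,
    ∫⁻ x, ENNReal.ofReal (f x - N) ∂Q.toMeasure ≤ ENNReal.ofReal η

namespace UniformUpperTail

variable {X : Type*} [MeasurableSpace X] {B : Set (ProbabilityMeasure X)} {f : X → ℝ}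

theorem exists_ge (h : UniformUpperTail B f) {η : ℝ} (hη : 0 < η) (N₀ : ℝ) : ∃ N : ℝ, N₀ ≤ N ∧
    ∀ Q ∈ B, ∫⁻ x, ENNReal.ofReal (f x - N) ∂Q.toMeasure ≤ ENNReal.ofReal η := by
  obtain ⟨N, hN⟩ := h η hη
  refine ⟨max N N₀, le_max_right _ _, fun Q hQ => le_trans (lintegral_mono fun x => ?_) (hN Q hQ)⟩
  exact ENNReal.ofReal_le_ofReal (sub_le_sub_left (le_max_left _ _) _)

theorem exists_integral_le (h : UniformUpperTail B f) (hf : Measurable f) : ∃ K : ℝ,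
    (∀ Q ∈ B, ∫⁻ x, ENNReal.ofReal (f x) ∂Q.toMeasure ≠ ⊤) ∧
    ∀ Q ∈ B, Integrable f Q.toMeasure → ∫ x, f x ∂Q.toMeasure ≤ K := by
  obtain ⟨N, hN0, hN⟩ := h.exists_ge one_pos 0
  have key : ∀ Q ∈ B, ∫⁻ x, ENNReal.ofReal (f x) ∂Q.toMeasure ≤ ENNReal.ofReal (N + 1) := by
    intro Q hQ
    calc ∫⁻ x, ENNReal.ofReal (f x) ∂Q.toMeasure
        ≤ ∫⁻ x, (ENNReal.ofReal N + ENNReal.ofReal (f x - N)) ∂Q.toMeasure := by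
          refine lintegral_mono fun x => ?_
          refine le_trans (ENNReal.ofReal_le_ofReal ?_) ENNReal.ofReal_add_le
          linarith
      _ ≤ ENNReal.ofReal N + ENNReal.ofReal 1 := by
          rw [lintegral_add_left measurable_const]
          simpa using hN Q hQ
      _ = ENNReal.ofReal (N + 1) := (ENNReal.ofReal_add hN0 zero_le_one).symm
  refine ⟨N + 1, fun Q hQ => ne_top_of_le_ne_top ofReal_ne_top (key Q hQ), fun Q hQ hint => ?_⟩
  calc ∫ x, f x ∂Q.toMeasure ≤ ∫ x, max (f x) 0 ∂Q.toMeasure :=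
        integral_mono hint hint.pos_part fun x => le_max_left _ _
    _ = (∫⁻ x, ENNReal.ofReal (f x) ∂Q.toMeasure).toReal := integral_max_zero_eq_toReal hf
    _ ≤ N + 1 := ENNReal.toReal_le_of_le_ofReal (by linarith) (key Q hQ)

theorem exists_isClosed_mem_iff [TopologicalSpace X] [TopologicalSpace.PseudoMetrizableSpace X]
    [TopologicalSpace.SeparableSpace X] [BorelSpace X] (h : UniformUpperTail B f)
    (hf : UpperSemicontinuous f) (v : ℝ) :
    ∃ T : Set (ProbabilityMeasure X), IsClosed T ∧
      ∀ Q ∈ B, Q ∈ T ↔ Integrable f Q.toMeasure ∧ v ≤ ∫ x, f x ∂Q.toMeasure := by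
  choose N hNv hN using fun k : ℕ => h.exists_ge (Nat.one_div_pos_of_nat (α := ℝ) (n := k)) v
  have hlsc (a : ℝ) : LowerSemicontinuous fun x => ENNReal.ofReal (a - f x) := by
    refine Continuous.comp_upperSemicontinuous_antitone
      (g := fun y : ℝ => ENNReal.ofReal (a - y)) (ENNReal.continuous_ofReal.comp (by fun_prop)) hf
      fun y z hyz => ?_
    exact ENNReal.ofReal_le_ofReal (sub_le_sub_left hyz _)
  refine ⟨⋂ k : ℕ, {Q | ∫⁻ x, ENNReal.ofReal (N k - f x) ∂Q.toMeasure
    ≤ ENNReal.ofReal (N k - v + 1 / ((k : ℝ) + 1))}, isClosed_iInter fun k =>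
      (lowerSemicontinuous_lintegral (hlsc (N k))).isClosed_preimage _, fun Q hQ => ?_⟩
  simp only [mem_iInter, mem_ofPred_eq]
  refine ⟨fun hT => ?_, fun ⟨hint, hv⟩ k => lintegral_ofReal_sub_le_of_le_integral hf.measurable
    (by positivity) (hN k Q hQ) hint hv⟩
  have key (k : ℕ) := integrable_and_le_integral_of_lintegral_ofReal_sub_le hf.measurable
    (hN k Q hQ) (add_nonneg (sub_nonneg.2 (hNv k)) (by positivity)) (hT k)
  refine ⟨(key 0).1, ?_⟩
  have hlim : Tendsto (fun k : ℕ => v - 1 / ((k : ℝ) + 1)) atTop (𝓝 (v - 0)) :=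
    tendsto_const_nhds.sub tendsto_one_div_add_atTop_nhds_zero_nat
  rw [sub_zero] at hlim
  exact le_of_tendsto' hlim fun k => (key k).2

end UniformUpperTail

theorem exists_forall_le_integral_of_finite {X E ι : Type*} [MeasurableSpace X]
    [AddCommGroup E] [Module ℝ E] [Fintype ι] [Nonempty ι] {Θ : Set E}
    {B : Set (ProbabilityMeasure X)} {F : E → X → ℝ}
    (hBconv : ∀ Q₁ ∈ B, ∀ Q₂ ∈ B, ∀ a b : ℝ, 0 ≤ a → 0 ≤ b → a + b = 1 →
      ∃ Q ∈ B, Q.toMeasure = ENNReal.ofReal a • Q₁.toMeasure + ENNReal.ofReal b • Q₂.toMeasure)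
    (hF : ∀ x, ConvexOn ℝ Θ fun θ => F θ x) (hmeas : ∀ θ ∈ Θ, Measurable (F θ))
    (htail : ∀ θ ∈ Θ, UniformUpperTail B (F θ)) {v v' : ℝ} (hvv' : v < v')
    (hsup : ∀ θ ∈ Θ, ∃ Q ∈ B, Integrable (F θ) Q.toMeasure ∧ v' < ∫ x, F θ x ∂Q.toMeasure)
    {θ : ι → E} (hθ : ∀ i, θ i ∈ Θ) :
    ∃ Q ∈ B, ∀ i, Integrable (F (θ i)) Q.toMeasure ∧ v ≤ ∫ x, F (θ i) x ∂Q.toMeasure := by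
  by_contra! hcon
  choose K hKtop hK using fun i => (htail _ (hθ i)).exists_integral_le (hmeas _ (hθ i))
  obtain ⟨K', hK'⟩ := (finite_range K).bddAbove
  set S : Set (ι → ℝ) := {y | ∃ Q ∈ B, ∀ i, Integrable (F (θ i)) Q.toMeasure ∧
    y i = ∫ x, F (θ i) x ∂Q.toMeasure - v}
  have hSconv : Convex ℝ S := by
    rintro y ⟨Q₁, hQ₁, hy⟩ z ⟨Q₂, hQ₂, hz⟩ a b ha hb hab
    obtain ⟨Q, hQ, hQeq⟩ := hBconv Q₁ hQ₁ Q₂ hQ₂ a b ha hb hab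
    refine ⟨Q, hQ, fun i => ?_⟩
    have h1 := (hy i).1.smul_measure (ofReal_ne_top (r := a))
    have h2 := (hz i).1.smul_measure (ofReal_ne_top (r := b))
    rw [hQeq]
    refine ⟨h1.add_measure h2, ?_⟩
    rw [integral_add_measure h1 h2, integral_smul_measure, integral_smul_measure,
      ENNReal.toReal_ofReal ha, ENNReal.toReal_ofReal hb]
    simp only [Pi.add_apply, Pi.smul_apply, smul_eq_mul, (hy i).2, (hz i).2]
    linear_combination -v * hab
  have hSneg : ∀ y ∈ S, ∃ i, y i ≤ 0 := by
    rintro y ⟨Q, hQ, hy⟩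
    obtain ⟨i, hi⟩ := hcon Q hQ
    exact ⟨i, by linarith [hi (hy i).1, (hy i).2]⟩
  have hSle : ∀ y ∈ S, ∀ i, y i ≤ K' - v := by
    rintro y ⟨Q, hQ, hy⟩ i
    linarith [(hy i).2, hK i Q hQ (hy i).1, hK' (mem_range_self i)]
  obtain ⟨w, hw0, hw1, hwS⟩ := exists_pos_weights hSconv hSneg hSle (sub_pos.2 hvv')
  have hmem : ∑ i, w i • θ i ∈ Θ :=
    (hF (Classical.choice (nonempty_of_isProbabilityMeasure
      (hsup _ (hθ (Classical.arbitrary ι))).choose.toMeasure))).1.sum_mem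
      (fun i _ => (hw0 i).le) hw1 fun i _ => hθ i
  have hjensen (x : X) : F (∑ i, w i • θ i) x ≤ ∑ i, w i * F (θ i) x :=
    (hF x).map_sum_le (fun i _ => (hw0 i).le) hw1 fun i _ => hθ i
  obtain ⟨Q, hQ, hint, hlt⟩ := hsup _ hmem
  have hints := integrable_of_integrable_le_sum hw0 (fun i => hmeas _ (hθ i))
    (fun i => hKtop i Q hQ) hint hjensen
  have h1 := hwS (fun i => ∫ x, F (θ i) x ∂Q.toMeasure - v) ⟨Q, hQ, fun i => ⟨hints i, rfl⟩⟩
  have h2 : ∫ x, F (∑ i, w i • θ i) x ∂Q.toMeasure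
      ≤ ∑ i, w i * ∫ x, F (θ i) x ∂Q.toMeasure := by
    refine (integral_mono hint (integrable_finsetSum _ fun i _ => (hints i).const_mul _)
      hjensen).trans_eq ?_
    rw [integral_finsetSum _ fun i _ => (hints i).const_mul _]
    simp only [integral_const_mul]
  have h3 : ∑ i, w i * (∫ x, F (θ i) x ∂Q.toMeasure - v)
      = ∑ i, w i * ∫ x, F (θ i) x ∂Q.toMeasure - v := by
    simp only [mul_sub, Finset.sum_sub_distrib, ← Finset.sum_mul, hw1, one_mul]
  linarith

theorem exists_forall_le_integral {X E : Type*} [MeasurableSpace X] [TopologicalSpace X]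
    [TopologicalSpace.PseudoMetrizableSpace X] [TopologicalSpace.SeparableSpace X] [BorelSpace X]
    [AddCommGroup E] [Module ℝ E] {Θ : Set E} {B : Set (ProbabilityMeasure X)} {F : E → X → ℝ}
    (hB : IsCompact B) (hBne : B.Nonempty)
    (hBconv : ∀ Q₁ ∈ B, ∀ Q₂ ∈ B, ∀ a b : ℝ, 0 ≤ a → 0 ≤ b → a + b = 1 →
      ∃ Q ∈ B, Q.toMeasure = ENNReal.ofReal a • Q₁.toMeasure + ENNReal.ofReal b • Q₂.toMeasure)
    (hF : ∀ x, ConvexOn ℝ Θ fun θ => F θ x) (husc : ∀ θ ∈ Θ, UpperSemicontinuous (F θ))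
    (htail : ∀ θ ∈ Θ, UniformUpperTail B (F θ)) {v : ℝ}
    (hsup : ∀ θ ∈ Θ, ∀ u < v, ∃ Q ∈ B,
      Integrable (F θ) Q.toMeasure ∧ u < ∫ x, F θ x ∂Q.toMeasure) :
    ∃ Q ∈ B, ∀ θ ∈ Θ, Integrable (F θ) Q.toMeasure ∧ v ≤ ∫ x, F θ x ∂Q.toMeasure := by
  choose T hTc hT using fun q : Θ × Iio v =>
    (htail q.1 q.1.2).exists_isClosed_mem_iff (husc q.1 q.1.2) q.2
  obtain ⟨Q, hQ, hQT⟩ := hB.inter_iInter_nonempty T hTc fun s => by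
    rcases s.eq_empty_or_nonempty with rfl | hs
    · simpa using hBne
    obtain ⟨q₀, -, hq₀⟩ := s.exists_max_image (fun q => (q.2 : ℝ)) hs
    obtain ⟨u, hu, huv⟩ := exists_between (show (q₀.2 : ℝ) < v from q₀.2.2)
    have : Nonempty s := hs.to_subtype
    obtain ⟨Q, hQ, h⟩ := exists_forall_le_integral_of_finite hBconv hF
      (fun θ hθ => (husc θ hθ).measurable) htail hu (fun θ hθ => hsup θ hθ u huv)
      (θ := fun q : s => (q.1.1 : E)) fun q => q.1.1.2
    refine ⟨Q, hQ, mem_iInter₂.2 fun q hq => (hT q Q hQ).2 ?_⟩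
    exact ⟨(h ⟨q, hq⟩).1, (hq₀ q hq).trans (h ⟨q, hq⟩).2⟩
  have key (θ : E) (hθ : θ ∈ Θ) (u : ℝ) (hu : u < v) :=
    (hT (⟨θ, hθ⟩, ⟨u, hu⟩) Q hQ).1 (mem_iInter.1 hQT _)
  exact ⟨Q, hQ, fun θ hθ => ⟨(key θ hθ (v - 1) (by linarith)).1,
    le_of_forall_lt fun u hu => by
      obtain ⟨u', h1, h2⟩ := exists_between hu
      exact h1.trans_le (key θ hθ u' h2).2⟩⟩

theorem exists_growth_sub_le {g r η : ℝ} {p : ℕ} (hg : 0 < g) (hr : 0 < r) (hrp : r < p)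
    (hη : 0 < η) : ∃ N : ℝ, ∀ x : ℝ, 0 ≤ x → g * (1 + x ^ r) - N ≤ η * x ^ p := by
  have hs : 0 < (p : ℝ) - r := sub_pos.2 hrp
  set x₀ : ℝ := (g / η) ^ ((p : ℝ) - r)⁻¹
  have hx₀ : 0 < x₀ := by positivity
  refine ⟨g + g * x₀ ^ r, fun x hx => ?_⟩
  rcases le_total x x₀ with h | h
  · have h1 : x ^ r ≤ x₀ ^ r := Real.rpow_le_rpow hx h hr.le
    have h2 : g * x ^ r ≤ g * x₀ ^ r := mul_le_mul_of_nonneg_left h1 hg.le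
    have h3 : 0 ≤ η * x ^ p := by positivity
    linarith
  · have hxpos : 0 < x := hx₀.trans_le h
    have h1 : g / η ≤ x ^ ((p : ℝ) - r) := by
      calc g / η = x₀ ^ ((p : ℝ) - r) := (Real.rpow_inv_rpow (by positivity) hs.ne').symm
        _ ≤ x ^ ((p : ℝ) - r) := Real.rpow_le_rpow hx₀.le h hs.le
    have h2 : x ^ p = x ^ ((p : ℝ) - r) * x ^ r := by
      rw [← Real.rpow_add hxpos, sub_add_cancel, Real.rpow_natCast]
    have h3 : g ≤ η * x ^ ((p : ℝ) - r) := by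
      rw [div_le_iff₀ hη] at h1
      linarith
    have h4 : g * x ^ r ≤ η * x ^ ((p : ℝ) - r) * x ^ r :=
      mul_le_mul_of_nonneg_right h3 (by positivity)
    have h5 : 0 ≤ g * x₀ ^ r := by positivity
    rw [h2]
    linarith

theorem uniformUpperTail_of_growth {X : Type*} [MeasurableSpace X]
    {B : Set (ProbabilityMeasure X)} {f ρ : X → ℝ} {p : ℕ} {g r : ℝ} {M : ℝ≥0∞}
    (hρ : ∀ x, 0 ≤ ρ x) (hM : M ≠ ⊤)
    (hB : ∀ Q ∈ B, ∫⁻ x, ENNReal.ofReal (ρ x ^ p) ∂Q.toMeasure ≤ M)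
    (hg : 0 < g) (hr : 0 < r) (hrp : r < p) (hf : ∀ x, f x ≤ g * (1 + ρ x ^ r)) :
    UniformUpperTail B f := by
  intro η hη
  have hM0 : 0 ≤ M.toReal := toReal_nonneg
  obtain ⟨N, hN⟩ := exists_growth_sub_le hg hr hrp (η := η / (M.toReal + 1)) (by positivity)
  refine ⟨N, fun Q hQ => ?_⟩
  calc ∫⁻ x, ENNReal.ofReal (f x - N) ∂Q.toMeasure
      ≤ ∫⁻ x, ENNReal.ofReal (η / (M.toReal + 1)) * ENNReal.ofReal (ρ x ^ p) ∂Q.toMeasure := by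
        refine lintegral_mono fun x => ?_
        rw [← ENNReal.ofReal_mul (by positivity)]
        exact ENNReal.ofReal_le_ofReal ((sub_le_sub_right (hf x) N).trans (hN _ (hρ x)))
    _ = ENNReal.ofReal (η / (M.toReal + 1)) * ∫⁻ x, ENNReal.ofReal (ρ x ^ p) ∂Q.toMeasure :=
        lintegral_const_mul' _ _ ofReal_ne_top
    _ ≤ ENNReal.ofReal (η / (M.toReal + 1)) * ENNReal.ofReal M.toReal := by
        rw [ENNReal.ofReal_toReal hM]
        exact mul_le_mul_right (hB Q hQ) _
    _ ≤ ENNReal.ofReal η := by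
        rw [← ENNReal.ofReal_mul (by positivity)]
        refine ENNReal.ofReal_le_ofReal ?_
        rw [div_mul_eq_mul_div, div_le_iff₀ (by positivity)]
        nlinarith

theorem add_three_pow_le {x y k : ℝ} (hx : 0 ≤ x) (hy : 0 ≤ y) (hk : 0 ≤ k) (p : ℕ) :
    (x + y + k) ^ p ≤ 3 ^ p * (x ^ p + y ^ p + k ^ p) := by
  have hxp := pow_nonneg hx p
  have hyp := pow_nonneg hy p
  have hkp := pow_nonneg hk p
  have hle : x + y + k ≤ 3 * max x (max y k) := by
    linarith [le_max_left x (max y k), (le_max_left y k).trans (le_max_right x _),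
      (le_max_right y k).trans (le_max_right x _)]
  refine (pow_le_pow_left₀ (by positivity) hle p).trans ?_
  rw [mul_pow]
  refine mul_le_mul_of_nonneg_left ?_ (by positivity)
  rcases max_choice x (max y k) with h | h
  · rw [h]; linarith
  · rw [h]
    rcases max_choice y k with h | h <;> rw [h] <;> linarith

section eint

variable {X : Type*} [MeasurableSpace X] {μ : Measure X} {f : X → EReal}

theorem erealPos_coe (y : ℝ) : erealPos (y : EReal) = ENNReal.ofReal y := by
  simp [erealPos]

theorem eint_coe (F : X → ℝ) : eint μ (fun x => (F x : EReal)) =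
    ((∫⁻ x, ENNReal.ofReal (F x) ∂μ : ℝ≥0∞) : EReal) -
      ((∫⁻ x, ENNReal.ofReal (-F x) ∂μ : ℝ≥0∞) : EReal) := by
  simp only [eint, ← EReal.coe_neg, erealPos_coe]

theorem eint_coe_of_integrable {F : X → ℝ} (hF : Integrable F μ) :
    eint μ (fun x => (F x : EReal)) = ((∫ x, F x ∂μ : ℝ) : EReal) := by
  rw [eint_coe, integral_eq_lintegral_pos_part_sub_lintegral_neg_part hF, EReal.coe_sub,
    EReal.coe_ennreal_toReal hF.lintegral_lt_top.ne,
    EReal.coe_ennreal_toReal (show ∫⁻ x, ENNReal.ofReal (-F x) ∂μ ≠ ⊤ from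
      hF.neg.lintegral_lt_top.ne)]

theorem eint_coe_of_not_integrable {F : X → ℝ} (hFm : Measurable F)
    (hpos : ∫⁻ x, ENNReal.ofReal (F x) ∂μ ≠ ⊤) (hF : ¬ Integrable F μ) :
    eint μ (fun x => (F x : EReal)) = ⊥ := by
  have hneg : ∫⁻ x, ENNReal.ofReal (-F x) ∂μ = ⊤ := by
    by_contra h
    have h1 := integrable_max_zero_of_lintegral_ofReal hFm hpos
    have h2 := integrable_max_zero_of_lintegral_ofReal (f := fun x => -F x) hFm.neg h
    refine hF ((h1.sub h2).congr (Eventually.of_forall fun x => ?_))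
    rcases le_total (F x) 0 with h | h <;> simp [h]
  rw [eint_coe, hneg]
  simp [sub_eq_add_neg]

end eint

section transport

variable {X : Type*} [MeasurableSpace X] {c : X → X → ℝ≥0∞} {P : ProbabilityMeasure X}

/-- Probability measures on the product with second marginal `P` and transport cost at most `a`. -/
def transportPlans (c : X → X → ℝ≥0∞) (P : ProbabilityMeasure X) (a : ℝ≥0∞) :
    Set (ProbabilityMeasure (X × X)) :=
  {π | π.toMeasure.map Prod.snd = P.toMeasure ∧ ∫⁻ q, c q.1 q.2 ∂π.toMeasure ≤ a}

theorem isClosed_setOf_map_eq {Y Z : Type*} [TopologicalSpace Y] [MeasurableSpace Y]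
    [OpensMeasurableSpace Y] [TopologicalSpace Z] [MeasurableSpace Z] [BorelSpace Z]
    [HasOuterApproxClosed Z] {φ : Y → Z} (hφ : Continuous φ) (hφm : Measurable φ)
    (R : ProbabilityMeasure Z) :
    IsClosed {π : ProbabilityMeasure Y | π.toMeasure.map φ = R.toMeasure} := by
  have : {π : ProbabilityMeasure Y | π.toMeasure.map φ = R.toMeasure} =
      (fun π : ProbabilityMeasure Y => π.map hφm.aemeasurable) ⁻¹' {R} := by
    ext π
    exact ProbabilityMeasure.toMeasure_injective.eq_iff (a := π.map hφm.aemeasurable) (b := R)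
  rw [this]
  exact isClosed_singleton.preimage (ProbabilityMeasure.continuous_map hφ)

variable [TopologicalSpace X] [TopologicalSpace.MetrizableSpace X] [SecondCountableTopology X]
  [BorelSpace X]

theorem isCompact_transportPlans (hc : LowerSemicontinuous fun q : X × X => c q.1 q.2)
    {a : ℝ≥0∞}
    (ht : IsTightMeasureSet
      {x : Measure (X × X) | ∃ π ∈ transportPlans c P a, π.toMeasure = x}) :
    IsCompact (transportPlans c P a) := by
  have hcl : IsClosed (transportPlans c P a) :=
    (isClosed_setOf_map_eq continuous_snd measurable_snd P).inter
      ((lowerSemicontinuous_lintegral hc).isClosed_preimage a)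
  have := isCompact_closure_of_isTightMeasureSet (S := transportPlans c P a) ht
  rwa [hcl.closure_eq] at this

theorem mem_ambiguitySet_iff_exists_transportPlan
    (hc : LowerSemicontinuous fun q : X × X => c q.1 q.2)
    (hcpt : ∀ a : ℝ≥0∞, a ≠ ⊤ → IsCompact (transportPlans c P a)) {ε : ℝ}
    {Q : ProbabilityMeasure X} :
    Q ∈ ambiguitySet c P ε ↔
      ∃ π ∈ transportPlans c P (ENNReal.ofReal ε), π.toMeasure.map Prod.fst = Q.toMeasure := by
  constructor
  · intro hQ
    have hlt : OTDiscrepancy c Q.toMeasure P.toMeasure < ENNReal.ofReal ε + 1 :=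
      (show _ ≤ _ from hQ).trans_lt (ENNReal.lt_add_right ofReal_ne_top one_ne_zero)
    have hprob (π : Measure (X × X)) (hπ : π ∈ couplings Q.toMeasure P.toMeasure) :
        IsProbabilityMeasure π := by
      refine ⟨?_⟩
      have : π.map Prod.fst univ = 1 := by rw [hπ.1]; exact measure_univ
      rwa [Measure.map_apply measurable_fst MeasurableSet.univ] at this
    set K := transportPlans c P (ENNReal.ofReal ε + 1) ∩
      {π : ProbabilityMeasure (X × X) | π.toMeasure.map Prod.fst = Q.toMeasure}
    have hK : IsCompact K := (hcpt _ (by finiteness)).inter_right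
      (isClosed_setOf_map_eq continuous_fst measurable_fst Q)
    have hmemK (π : Measure (X × X)) (hπ : π ∈ couplings Q.toMeasure P.toMeasure)
        (hcost : ∫⁻ q, c q.1 q.2 ∂π ≤ ENNReal.ofReal ε + 1) :
        (⟨π, hprob π hπ⟩ : ProbabilityMeasure (X × X)) ∈ K := ⟨⟨hπ.2, hcost⟩, hπ.1⟩
    obtain ⟨π₀, hπ₀, hcost₀⟩ : ∃ π ∈ couplings Q.toMeasure P.toMeasure,
        ∫⁻ q, c q.1 q.2 ∂π < ENNReal.ofReal ε + 1 := by
      simpa only [OTDiscrepancy, iInf_lt_iff, exists_prop] using hlt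
    have hKne : K.Nonempty := ⟨_, hmemK π₀ hπ₀ hcost₀.le⟩
    obtain ⟨π, hπK, hπmin⟩ := LowerSemicontinuousOn.exists_isMinOn hKne hK ((lowerSemicontinuous_lintegral hc).lowerSemicontinuousOn K)
    have hle : ∫⁻ q, c q.1 q.2 ∂π.toMeasure ≤ OTDiscrepancy c Q.toMeasure P.toMeasure := by
      refine le_iInf₂ fun π' hπ' => ?_
      rcases le_total (∫⁻ q, c q.1 q.2 ∂π') (ENNReal.ofReal ε + 1) with h | h
      · exact isMinOn_iff.1 hπmin _ (hmemK π' hπ' h)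
      · exact hπK.1.2.trans h
    exact ⟨π, ⟨hπK.1.1, hle.trans hQ⟩, hπK.2⟩
  · rintro ⟨π, ⟨hπ, hcost⟩, hπQ⟩
    have hmem : π.toMeasure ∈ couplings Q.toMeasure P.toMeasure := ⟨hπQ, hπ⟩
    have hle : OTDiscrepancy c Q.toMeasure P.toMeasure ≤ ∫⁻ q, c q.1 q.2 ∂π.toMeasure :=
      iInf₂_le π.toMeasure hmem
    exact hle.trans hcost

theorem isCompact_ambiguitySet (hc : LowerSemicontinuous fun q : X × X => c q.1 q.2)
    (hcpt : ∀ a : ℝ≥0∞, a ≠ ⊤ → IsCompact (transportPlans c P a)) (ε : ℝ) :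
    IsCompact (ambiguitySet c P ε) := by
  have : ambiguitySet c P ε = (fun π : ProbabilityMeasure (X × X) =>
      π.map measurable_fst.aemeasurable) '' transportPlans c P (ENNReal.ofReal ε) := by
    ext Q
    rw [mem_ambiguitySet_iff_exists_transportPlan hc hcpt]
    exact exists_congr fun π => and_congr_right fun _ =>
      ProbabilityMeasure.toMeasure_injective.eq_iff (a := π.map measurable_fst.aemeasurable) (b := Q)
  rw [this]
  exact (hcpt _ ofReal_ne_top).image (ProbabilityMeasure.continuous_map continuous_fst)

theorem exists_mem_ambiguitySet_eq_add (hc : LowerSemicontinuous fun q : X × X => c q.1 q.2)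
    (hcpt : ∀ a : ℝ≥0∞, a ≠ ⊤ → IsCompact (transportPlans c P a)) {ε : ℝ}
    {Q₁ Q₂ : ProbabilityMeasure X} (hQ₁ : Q₁ ∈ ambiguitySet c P ε) (hQ₂ : Q₂ ∈ ambiguitySet c P ε)
    {a b : ℝ} (ha : 0 ≤ a) (hb : 0 ≤ b) (hab : a + b = 1) :
    ∃ Q ∈ ambiguitySet c P ε,
      Q.toMeasure = ENNReal.ofReal a • Q₁.toMeasure + ENNReal.ofReal b • Q₂.toMeasure := by
  have hsum : ENNReal.ofReal a + ENNReal.ofReal b = 1 := by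
    rw [← ENNReal.ofReal_add ha hb, hab, ENNReal.ofReal_one]
  have hprob {Y : Type _} [MeasurableSpace Y] (μ ν : ProbabilityMeasure Y) : IsProbabilityMeasure
      (ENNReal.ofReal a • μ.toMeasure + ENNReal.ofReal b • ν.toMeasure) :=
    ⟨by simp [hsum]⟩
  obtain ⟨π₁, ⟨hπ₁, hcost₁⟩, hfst₁⟩ := (mem_ambiguitySet_iff_exists_transportPlan hc hcpt).1 hQ₁
  obtain ⟨π₂, ⟨hπ₂, hcost₂⟩, hfst₂⟩ := (mem_ambiguitySet_iff_exists_transportPlan hc hcpt).1 hQ₂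
  refine ⟨⟨_, hprob Q₁ Q₂⟩, (mem_ambiguitySet_iff_exists_transportPlan hc hcpt).2
    ⟨⟨_, hprob π₁ π₂⟩, ⟨?_, ?_⟩, ?_⟩, rfl⟩
  · simp only [ProbabilityMeasure.coe_mk]
    rw [Measure.map_add _ _ measurable_snd, Measure.map_smul, Measure.map_smul, hπ₁, hπ₂,
      ← add_smul, hsum, one_smul]
  · simp only [ProbabilityMeasure.coe_mk]
    rw [lintegral_add_measure, lintegral_smul_measure, lintegral_smul_measure]
    calc ENNReal.ofReal a • ∫⁻ q, c q.1 q.2 ∂π₁.toMeasure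
          + ENNReal.ofReal b • ∫⁻ q, c q.1 q.2 ∂π₂.toMeasure
        ≤ ENNReal.ofReal a • ENNReal.ofReal ε + ENNReal.ofReal b • ENNReal.ofReal ε := by gcongr
      _ = ENNReal.ofReal ε := by rw [← add_smul, hsum, one_smul]
  · simp only [ProbabilityMeasure.coe_mk]
    rw [Measure.map_add _ _ measurable_fst, Measure.map_smul, Measure.map_smul, hfst₁, hfst₂]

end transport

section moment

variable {X : Type*} [MeasurableSpace X] {c : X → X → ℝ≥0∞} {P : ProbabilityMeasure X}
  {δ : X → X → ℝ} {p : ℕ}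

theorem lintegral_pow_le_of_mem_transportPlans
    (hc : Measurable fun q : X × X => c q.1 q.2) (hδ0 : ∀ x y, 0 ≤ δ x y)
    (hδ_tri : ∀ x y z : X, δ x z ≤ δ x y + δ y z)
    (hcδ : ∀ x y, ENNReal.ofReal (δ x y ^ p) ≤ c x y) (x₀ x₁ : X) {a : ℝ≥0∞}
    {π : ProbabilityMeasure (X × X)} (hπ : π ∈ transportPlans c P a) :
    ∫⁻ q, ENNReal.ofReal (δ q.1 x₁ ^ p) ∂π.toMeasure ≤
      ENNReal.ofReal (3 ^ p) *
        (a + ∫⁻ x, c x x₀ ∂P.toMeasure + ENNReal.ofReal (δ x₀ x₁ ^ p)) := by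
  have hcx₀ : Measurable fun x => c x x₀ := hc.comp (measurable_id.prodMk measurable_const)
  have hpt (q : X × X) : ENNReal.ofReal (δ q.1 x₁ ^ p) ≤
      ENNReal.ofReal (3 ^ p) * (c q.1 q.2 + c q.2 x₀ + ENNReal.ofReal (δ x₀ x₁ ^ p)) := by
    have h1 : δ q.1 x₁ ^ p ≤ 3 ^ p * (δ q.1 q.2 ^ p + δ q.2 x₀ ^ p + δ x₀ x₁ ^ p) := by
      refine (pow_le_pow_left₀ (hδ0 _ _) ?_ p).trans
        (add_three_pow_le (hδ0 _ _) (hδ0 _ _) (hδ0 _ _) p)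
      linarith [hδ_tri q.1 q.2 x₁, hδ_tri q.2 x₀ x₁]
    have h2 := pow_nonneg (hδ0 q.1 q.2) p
    have h3 := pow_nonneg (hδ0 q.2 x₀) p
    have h4 := pow_nonneg (hδ0 x₀ x₁) p
    refine (ENNReal.ofReal_le_ofReal h1).trans ?_
    rw [ENNReal.ofReal_mul (by positivity), ENNReal.ofReal_add (by positivity) h4,
      ENNReal.ofReal_add h2 h3]
    gcongr
    · exact hcδ _ _
    · exact hcδ _ _
  refine (lintegral_mono hpt).trans ?_
  rw [lintegral_const_mul' _ _ ofReal_ne_top, lintegral_add_right _ measurable_const,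
    lintegral_add_left hc, lintegral_const, measure_univ, mul_one]
  gcongr
  · exact hπ.2
  · rw [← hπ.1, lintegral_map hcx₀ measurable_snd]

theorem isTightMeasureSet_transportPlans [TopologicalSpace X]
    (hc : Measurable fun q : X × X => c q.1 q.2) (hδ0 : ∀ x y, 0 ≤ δ x y)
    (hδ_tri : ∀ x y z : X, δ x z ≤ δ x y + δ y z) (hδm : ∀ y, Measurable fun x => δ x y)
    (hδ_cpt : ∀ (y : X) (r : ℝ), IsCompact {x | δ x y ≤ r}) (hp : 1 ≤ p)
    (hcδ : ∀ x y, ENNReal.ofReal (δ x y ^ p) ≤ c x y) {x₀ : X}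
    (hmom : ∫⁻ x, c x x₀ ∂P.toMeasure ≠ ⊤) {a : ℝ≥0∞} (ha : a ≠ ⊤) :
    IsTightMeasureSet
      {x : Measure (X × X) | ∃ π ∈ transportPlans c P a, π.toMeasure = x} := by
  have hm : Measurable fun x => ENNReal.ofReal (δ x x₀ ^ p) := ((hδm x₀).pow_const p).ennreal_ofReal
  refine isTightMeasureSet_of_lintegral_le
    (V := fun q : X × X => ENNReal.ofReal (δ q.1 x₀ ^ p) + ENNReal.ofReal (δ q.2 x₀ ^ p))
    (M := ENNReal.ofReal (3 ^ p) *
      (a + ∫⁻ x, c x x₀ ∂P.toMeasure + ENNReal.ofReal (δ x₀ x₀ ^ p)) +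
        ∫⁻ x, c x x₀ ∂P.toMeasure)
    ((hm.comp measurable_fst).add (hm.comp measurable_snd)) (fun r hr => ?_) (by finiteness) ?_
  · refine ⟨_, (hδ_cpt x₀ (r.toReal + 1)).prod (hδ_cpt x₀ (r.toReal + 1)), fun q hq => ?_⟩
    have hbd (x : X) (hx : ENNReal.ofReal (δ x x₀ ^ p) ≤ r) : δ x x₀ ≤ r.toReal + 1 := by
      by_contra! h
      have h1 : δ x x₀ ^ p ≤ r.toReal := (ENNReal.ofReal_le_iff_le_toReal hr).1 hx
      have h2 : (0 : ℝ) ≤ r.toReal := toReal_nonneg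
      have h3 : δ x x₀ ≤ δ x x₀ ^ p := le_self_pow₀ (by linarith) (by omega)
      linarith
    exact ⟨hbd _ (le_self_add.trans hq), hbd _ (le_add_self.trans hq)⟩
  · rintro _ ⟨π, hπ, rfl⟩
    rw [lintegral_add_left (f := fun q : X × X => ENNReal.ofReal (δ q.1 x₀ ^ p))
      (hm.comp measurable_fst)]
    refine add_le_add (lintegral_pow_le_of_mem_transportPlans hc hδ0 hδ_tri hcδ x₀ x₀ hπ) ?_
    rw [← lintegral_map (f := fun x => ENNReal.ofReal (δ x x₀ ^ p)) hm measurable_snd, hπ.1]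
    exact lintegral_mono fun x => hcδ x x₀

end moment

/-- **Minimax theorem, part (ii).**
For a convex feasible set and a loss convex in `θ`, under lower semicontinuity of the cost,
upper semicontinuity and integrability of the loss in `z`, a moment bound, domination of
the `p`-th power of a metric with compact sublevel sets, sublinear growth of the loss, and
properness of the dual DRO problem, the primal and dual DRO problems share the same optimal
value and the supremum over `Q` is attained. -/
theorem minimax_sup_attained {d m : ℕ}
    (𝒵 : Set (Fin d → ℝ)) (h𝒵closed : IsClosed 𝒵) (h𝒵ne : 𝒵.Nonempty)
    (Θ : Set (Fin m → ℝ)) (hΘclosed : IsClosed Θ) (hΘne : Θ.Nonempty)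
    (hΘconv : Convex ℝ Θ)
    (c : 𝒵 → 𝒵 → ℝ≥0∞) (hc_id : ∀ z zhat : 𝒵, c z zhat = 0 ↔ z = zhat)
    (Phat : ProbabilityMeasure 𝒵)
    (ℓ : (Fin m → ℝ) → 𝒵 → EReal) (hℓbot : ∀ θ z, ℓ θ z ≠ ⊥)
    (hℓconv : ∀ z : 𝒵, ∀ θ₁ ∈ Θ, ∀ θ₂ ∈ Θ, ∀ a b : ℝ, 0 ≤ a → 0 ≤ b → a + b = 1 →
      ℓ (a • θ₁ + b • θ₂) z ≤ (a : EReal) * ℓ θ₁ z + (b : EReal) * ℓ θ₂ z)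
    (ε : ℝ) (hε : 0 ≤ ε)
    -- (a) the cost is lower semicontinuous
    (hc_lsc : LowerSemicontinuous (fun q : 𝒵 × 𝒵 => c q.1 q.2))
    -- (b) the loss is upper semicontinuous and `P̂`-integrable in `z`
    (h_usc : ∀ θ ∈ Θ, UpperSemicontinuous (fun z : 𝒵 => ℓ θ z))
    (h_int : ∀ θ ∈ Θ, (∫⁻ z, erealPos (ℓ θ z) ∂Phat.toMeasure) ≠ ⊤ ∧
      (∫⁻ z, erealPos (-(ℓ θ z)) ∂Phat.toMeasure) ≠ ⊤)
    -- (c) moment bound at a reference point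
    (zhat₀ : 𝒵) (C : ℝ) (hC : ∫⁻ z, c z zhat₀ ∂Phat.toMeasure ≤ ENNReal.ofReal C)
    -- (d) a metric with compact sublevel sets dominated by the cost
    (δ : 𝒵 → 𝒵 → ℝ)
    (hδ_id : ∀ z zhat : 𝒵, δ z zhat = 0 ↔ z = zhat)
    (hδ_symm : ∀ z zhat : 𝒵, δ z zhat = δ zhat z)
    (hδ_tri : ∀ x y z : 𝒵, δ x z ≤ δ x y + δ y z)
    (hδ_cpt : ∀ (zhat : 𝒵) (r : ℝ), IsCompact {z : 𝒵 | δ z zhat ≤ r})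
    (p : ℕ) (hp : 1 ≤ p)
    (hcδ : ∀ z zhat : 𝒵, ENNReal.ofReal (δ z zhat ^ p) ≤ c z zhat)
    -- (e) growth condition of order `r < p` on the loss
    (h_growth : ∀ θ ∈ Θ, ∃ g : ℝ, 0 < g ∧ ∃ zhat₁ : 𝒵, ∃ r : ℝ, 0 < r ∧ r < (p : ℝ) ∧
      ∀ z : 𝒵, ℓ θ z ≤ ((g * (1 + δ z zhat₁ ^ r) : ℝ) : EReal))
    -- (f) properness of the dual problem
    (h_proper : ∃ Q ∈ ambiguitySet c Phat ε,
      ⊥ < (⨅ θ ∈ Θ, eint Q.toMeasure (ℓ θ))) :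
    (⨅ θ ∈ Θ, ⨆ Q ∈ ambiguitySet c Phat ε, eint Q.toMeasure (ℓ θ)) =
      (⨆ Q ∈ ambiguitySet c Phat ε, ⨅ θ ∈ Θ, eint Q.toMeasure (ℓ θ)) ∧
    ∃ Qstar ∈ ambiguitySet c Phat ε,
      (⨅ θ ∈ Θ, eint Qstar.toMeasure (ℓ θ)) =
        (⨆ Q ∈ ambiguitySet c Phat ε, ⨅ θ ∈ Θ, eint Q.toMeasure (ℓ θ)) := by
  set B := ambiguitySet c Phat ε
  have hδ0 (x y : 𝒵) : 0 ≤ δ x y := by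
    linarith [hδ_tri x y x, hδ_symm x y, (hδ_id x x).2 rfl]
  have hδm (y : 𝒵) : Measurable fun x => δ x y :=
    measurable_of_Iic fun r => (hδ_cpt y r).isClosed.measurableSet
  have hcm : Measurable fun q : 𝒵 × 𝒵 => c q.1 q.2 := hc_lsc.measurable
  have hmom : ∫⁻ z, c z zhat₀ ∂Phat.toMeasure ≠ ⊤ := ne_top_of_le_ne_top ofReal_ne_top hC
  have hcpt (a : ℝ≥0∞) (ha : a ≠ ⊤) : IsCompact (transportPlans c Phat a) :=
    isCompact_transportPlans hc_lsc
      (isTightMeasureSet_transportPlans hcm hδ0 hδ_tri hδm hδ_cpt hp hcδ hmom ha)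
  have hBmom (z₁ : 𝒵) (Q : ProbabilityMeasure 𝒵) (hQ : Q ∈ B) :
      ∫⁻ z, ENNReal.ofReal (δ z z₁ ^ p) ∂Q.toMeasure ≤ ENNReal.ofReal (3 ^ p) *
        (ENNReal.ofReal ε + ∫⁻ z, c z zhat₀ ∂Phat.toMeasure
          + ENNReal.ofReal (δ zhat₀ z₁ ^ p)) := by
    obtain ⟨π, hπ, hπQ⟩ := (mem_ambiguitySet_iff_exists_transportPlan hc_lsc hcpt).1 hQ
    rw [← hπQ, lintegral_map ((hδm z₁).pow_const p).ennreal_ofReal measurable_fst]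
    exact lintegral_pow_le_of_mem_transportPlans hcm hδ0 hδ_tri hcδ zhat₀ z₁ hπ
  have hℓtop (θ) (hθ : θ ∈ Θ) (z : 𝒵) : ℓ θ z ≠ ⊤ := by
    obtain ⟨g, -, z₁, r, -, -, h⟩ := h_growth θ hθ
    exact ((h z).trans_lt (EReal.coe_lt_top _)).ne
  set F : (Fin m → ℝ) → 𝒵 → ℝ := fun θ z => (ℓ θ z).toReal
  have hFℓ (θ) (hθ : θ ∈ Θ) (z : 𝒵) : (F θ z : EReal) = ℓ θ z :=
    EReal.coe_toReal (hℓtop θ hθ z) (hℓbot θ z)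
  have hFℓ' (θ) (hθ : θ ∈ Θ) : ℓ θ = fun z => (F θ z : EReal) := funext fun z => (hFℓ θ hθ z).symm
  have hFconv (z : 𝒵) : ConvexOn ℝ Θ fun θ => F θ z := by
    refine ⟨hΘconv, fun θ₁ h₁ θ₂ h₂ a b ha hb hab => ?_⟩
    have h := hℓconv z θ₁ h₁ θ₂ h₂ a b ha hb hab
    rw [← hFℓ _ (hΘconv h₁ h₂ ha hb hab), ← hFℓ _ h₁, ← hFℓ _ h₂] at h
    exact_mod_cast h
  have hFusc (θ) (hθ : θ ∈ Θ) : UpperSemicontinuous (F θ) := by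
    intro z y hy
    have h : ℓ θ z < (y : EReal) := by
      rw [← hFℓ θ hθ]
      exact_mod_cast hy
    filter_upwards [h_usc θ hθ z y h] with z' hz'
    rw [← hFℓ θ hθ] at hz'
    exact_mod_cast hz'
  have hFtail (θ) (hθ : θ ∈ Θ) : UniformUpperTail B (F θ) := by
    obtain ⟨g, hg, z₁, r, hr, hrp, h⟩ := h_growth θ hθ
    refine uniformUpperTail_of_growth (fun z => hδ0 z z₁) (by finiteness) (hBmom z₁) hg hr hrp
      fun z => ?_
    have := h z
    rw [← hFℓ θ hθ] at this
    exact_mod_cast this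
  have hpos (θ) (hθ : θ ∈ Θ) := (hFtail θ hθ).exists_integral_le (hFusc θ hθ).measurable
  obtain ⟨Q₀, hQ₀, -⟩ := h_proper
  have hBne : B.Nonempty := ⟨Q₀, hQ₀⟩
  obtain ⟨Qstar, hQstar, hge⟩ : ∃ Q ∈ B, (⨅ θ ∈ Θ, ⨆ Q ∈ B, eint Q.toMeasure (ℓ θ)) ≤
      ⨅ θ ∈ Θ, eint Q.toMeasure (ℓ θ) := by
    have hlt (u : ℝ) (hu : (u : EReal) < ⨅ θ ∈ Θ, ⨆ Q ∈ B, eint Q.toMeasure (ℓ θ)) (θ)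
        (hθ : θ ∈ Θ) : ∃ Q ∈ B, Integrable (F θ) Q.toMeasure ∧ u < ∫ z, F θ z ∂Q.toMeasure := by
      obtain ⟨Q, hQ, huQ⟩ := lt_biSup_iff.1 (hu.trans_le (iInf₂_le θ hθ))
      obtain ⟨K, hK, -⟩ := hpos θ hθ
      rw [hFℓ' θ hθ] at huQ
      have hint : Integrable (F θ) Q.toMeasure := by
        by_contra hint
        rw [eint_coe_of_not_integrable (hFusc θ hθ).measurable (hK Q hQ) hint] at huQ
        exact not_lt_bot huQ
      rw [eint_coe_of_integrable hint] at huQ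
      exact ⟨Q, hQ, hint, by exact_mod_cast huQ⟩
    induction hv : (⨅ θ ∈ Θ, ⨆ Q ∈ B, eint Q.toMeasure (ℓ θ)) with
    | bot => exact ⟨Q₀, hQ₀, bot_le⟩
    | top =>
      obtain ⟨θ, hθ⟩ := hΘne
      obtain ⟨K, -, hK⟩ := hpos θ hθ
      obtain ⟨Q, hQ, hint, h⟩ := hlt K (hv ▸ EReal.coe_lt_top K) θ hθ
      exact absurd (hK Q hQ hint) h.not_ge
    | coe v =>
      obtain ⟨Q, hQ, h⟩ := exists_forall_le_integral
        (isCompact_ambiguitySet hc_lsc hcpt ε) hBne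
        (fun Q₁ hQ₁ Q₂ hQ₂ a b ha hb hab =>
          exists_mem_ambiguitySet_eq_add hc_lsc hcpt hQ₁ hQ₂ ha hb hab)
        hFconv hFusc hFtail
        (v := v) fun θ hθ u hu => hlt u (hv ▸ EReal.coe_lt_coe_iff.2 hu) θ hθ
      refine ⟨Q, hQ, le_iInf₂ fun θ hθ => ?_⟩
      rw [hFℓ' θ hθ, eint_coe_of_integrable (h θ hθ).1]
      exact_mod_cast (h θ hθ).2
  have hweak : (⨆ Q ∈ B, ⨅ θ ∈ Θ, eint Q.toMeasure (ℓ θ)) ≤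
      ⨅ θ ∈ Θ, ⨆ Q ∈ B, eint Q.toMeasure (ℓ θ) :=
    le_iInf₂ fun θ hθ => iSup₂_mono fun Q _ => iInf₂_le θ hθ
  have hle : (⨅ θ ∈ Θ, eint Qstar.toMeasure (ℓ θ)) ≤
      ⨆ Q ∈ B, ⨅ θ ∈ Θ, eint Q.toMeasure (ℓ θ) :=
    le_iSup₂ (f := fun (Q : ProbabilityMeasure 𝒵) (_ : Q ∈ B) =>
      ⨅ θ ∈ Θ, eint Q.toMeasure (ℓ θ)) Qstar hQstar
  exact ⟨le_antisymm (hge.trans hle) hweak, Qstar, hQstar,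
    le_antisymm hle (hweak.trans hge)⟩
end
end
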